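/- The structure constants with all but one index vanishing admit the closed form R_{{k,0,…,0},{l,0,…,0}} (with a trailing zeros in each tuple) = binomial(k+a, a) / [(k+l+a+1)·(k+l+a)···(k+l+2)], i.e. R_{{k,0^a},{l,0^a}} = C(k+a,a)/[k+l+a+1]_a where [x]_a = x(x-1)⋯(x-a+1) is the falling factorial; similarly R_{{0^a,k̃},{0^a,l̃}} = C(l̃+a,a)/[k̃+l̃+a+1]_a. -/

import Mathlib

/-!
Statement 4: The structure constants with all but one index vanishing admit the closed
forms R_{{k,0^a},{l,0^a}} = C(k+a,a)/[k+l+a+1]_a and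
R_{{0^a,k̃},{0^a,l̃}} = C(l̃+a,a)/[k̃+l̃+a+1]_a, where [x]_a is the falling factorial.
-/

noncomputable section

open scoped BigOperators

abbrev FA := FreeAlgebra ℂ (Fin 2)

def Xg (i : Fin 2) : FA := FreeAlgebra.ι ℂ i

def Cc : FA := Xg 0 * Xg 1 - Xg 1 * Xg 0

def Xs (l : ℂ × ℂ) : FA := l.1 • Xg 0 + l.2 • Xg 1

def bra (l₁ l₂ : ℂ × ℂ) : ℂ := l₁.1 * l₂.2 - l₁.2 * l₂.1

/-- the doubly-graded symmetrized monomial `X^{k,l}(λ₁,λ₂)` -/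
def Xkl (l₁ l₂ : ℂ × ℂ) (k l : ℕ) : FA :=
  ((Nat.choose (k + l) k : ℂ))⁻¹ •
    ∑ S ∈ Finset.powersetCard k (Finset.univ : Finset (Fin (k + l))),
      (List.ofFn fun i => if i ∈ S then Xs l₁ else Xs l₂).prod

/-- the chain `X^{k₁,l₁}(λ₁,λ₂)·C·X^{k₂,l₂}(λ₁,λ₂)·C⋯C·X^{k_{a+1},l_{a+1}}(λ₁,λ₂)` -/
def chain (l₁ l₂ : ℂ × ℂ) {a : ℕ} (ks ls : Fin a → ℕ) : FA :=
  ((List.ofFn fun i => Xkl l₁ l₂ (ks i) (ls i)).intersperse Cc).prod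

/-- `R` is the family of structure constants of the celestial expansion. -/
def SatisfiesExpansion (R : List ℕ → List ℕ → ℂ) : Prop :=
  ∀ (m n : ℕ) (l₁ l₂ : ℂ × ℂ),
    Xs l₁ ^ m * Xs l₂ ^ n =
      ∑ a ∈ Finset.range (min m n + 1),
        bra l₁ l₂ ^ a •
          ∑ ks ∈ Finset.Nat.antidiagonalTuple (a + 1) (m - a),
            ∑ ls ∈ Finset.Nat.antidiagonalTuple (a + 1) (n - a),
              R (List.ofFn ks) (List.ofFn ls) • chain l₁ l₂ ks ls

open Finset

/-- The sum of all words of length `N` in which `x` occurs `k` times and `y` occurs `N - k` times. -/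
def wordSum {A : Type*} [Ring A] (x y : A) (N k : ℕ) : A :=
  ∑ S ∈ powersetCard k (univ : Finset (Fin N)),
    (List.ofFn fun i => if i ∈ S then x else y).prod

section wordSum

variable {A : Type*} [Ring A] (x y : A)

theorem wordSum_of_lt {N k : ℕ} (h : N < k) : wordSum x y N k = 0 := by
  rw [wordSum, powersetCard_eq_empty.2 (by simpa using h), sum_empty]

theorem wordSum_zero_zero : wordSum x y 0 0 = 1 := by
  simp [wordSum]

theorem sum_powersetCard_map_succ (N k : ℕ) (x₀ : A)
    (g : Finset (Fin (N + 1)) → Finset (Fin (N + 1)))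
    (hg₀ : ∀ T : Finset (Fin N), (if (0 : Fin (N + 1)) ∈ g (T.map (Fin.succEmb N)) then x else y) = x₀)
    (hg : ∀ (T : Finset (Fin N)) (i : Fin N), Fin.succ i ∈ g (T.map (Fin.succEmb N)) ↔ i ∈ T) :
    ∑ S ∈ powersetCard k (univ.map (Fin.succEmb N)),
      (List.ofFn fun i => if i ∈ g S then x else y).prod = x₀ * wordSum x y N k := by
  rw [powersetCard_map, sum_map, wordSum, mul_sum]
  refine sum_congr rfl fun T _ => ?_
  simp only [mapEmbedding_apply, RelEmbedding.coe_toEmbedding, List.ofFn_succ, List.prod_cons,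
    hg]
  congr 1
  exact hg₀ T

theorem univ_fin_succ (N : ℕ) :
    (univ : Finset (Fin (N + 1))) = insert 0 (univ.map (Fin.succEmb N)) := by
  rw [Fin.univ_succ, cons_eq_insert]
  rfl

theorem zero_notMem_map_succ {N : ℕ} (T : Finset (Fin N)) :
    (0 : Fin (N + 1)) ∉ T.map (Fin.succEmb N) := by
  simp [Fin.succ_ne_zero]

theorem wordSum_succ_zero (N : ℕ) : wordSum x y (N + 1) 0 = y * wordSum x y N 0 := by
  simp [wordSum, List.ofFn_succ]

theorem wordSum_succ_succ (N k : ℕ) :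
    wordSum x y (N + 1) (k + 1) = x * wordSum x y N k + y * wordSum x y N (k + 1) := by
  have h0 := zero_notMem_map_succ (univ : Finset (Fin N))
  have hnot : ∀ S ∈ powersetCard k (univ.map (Fin.succEmb N)), (0 : Fin (N + 1)) ∉ S :=
    fun S hS h => h0 ((mem_powersetCard.1 hS).1 h)
  rw [wordSum, univ_fin_succ, powersetCard_succ_insert h0, sum_union, sum_image, add_comm]
  · congr 1
    · exact sum_powersetCard_map_succ x y N k x (insert 0) (by simp) (by simp [Fin.succ_ne_zero])
    · exact sum_powersetCard_map_succ x y N (k + 1) y id (by simp [Fin.succ_ne_zero]) (by simp)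
  · intro S hS T hT h
    rw [← erase_insert (hnot S hS), h, erase_insert (hnot T hT)]
  · rw [disjoint_left]
    intro S hS hS'
    obtain ⟨T, -, rfl⟩ := mem_image.1 hS'
    exact h0 ((mem_powersetCard.1 hS).1 (mem_insert_self _ _))

theorem wordSum_succ_zero' (N : ℕ) : wordSum x y (N + 1) 0 = wordSum x y N 0 * y := by
  induction N with
  | zero => simp [wordSum_succ_zero, wordSum_zero_zero]
  | succ N ih => rw [wordSum_succ_zero, ih, ← mul_assoc, ← wordSum_succ_zero, ih]

theorem wordSum_succ_succ' (N k : ℕ) :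
    wordSum x y (N + 1) (k + 1) = wordSum x y N k * x + wordSum x y N (k + 1) * y := by
  induction N generalizing k with
  | zero =>
    cases k <;> simp [wordSum_succ_succ, wordSum_zero_zero, wordSum_of_lt]
  | succ N ih =>
    cases k with
    | zero =>
      conv_lhs => rw [wordSum_succ_succ, ih, wordSum_succ_zero']
      conv_rhs => rw [wordSum_succ_succ, wordSum_succ_zero]
      noncomm_ring
    | succ k =>
      conv_lhs => rw [wordSum_succ_succ, ih, ih]
      conv_rhs => rw [wordSum_succ_succ, wordSum_succ_succ]
      noncomm_ring

end wordSum

/-- Arrays of coefficients of power series `∑ f i j • x ^ i * y ^ j`. -/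
abbrev Coeffs := ℕ → ℕ → ℂ

/-- The coefficients of `x ^ k * y ^ l`. -/
def mono (k l : ℕ) : Coeffs := fun i j => if i = k ∧ j = l then 1 else 0

/-- The operator `x + (d (d + 1))⁻¹ ∂_y`, with `d` the degree. -/
def opX : Module.End ℂ Coeffs where
  toFun f := fun i j => (match i with | 0 => 0 | i + 1 => f i j) +
    (j + 1) / ((i + j + 1) * (i + j + 2)) * f i (j + 1)
  map_add' f g := by
    funext i j
    cases i <;> simp <;> ring
  map_smul' c f := by
    funext i j
    cases i <;> simp <;> ring

/-- The operator `y - (d (d + 1))⁻¹ ∂_x`, with `d` the degree. -/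
def opY : Module.End ℂ Coeffs where
  toFun f := fun i j => (match j with | 0 => 0 | j + 1 => f i j) -
    (i + 1) / ((i + j + 1) * (i + j + 2)) * f (i + 1) j
  map_add' f g := by
    funext i j
    cases j <;> simp <;> ring
  map_smul' c f := by
    funext i j
    cases j <;> simp <;> ring

theorem opX_zero (f : Coeffs) (j : ℕ) :
    opX f 0 j = (j + 1) / ((j + 1) * (j + 2)) * f 0 (j + 1) := by
  simp [opX]

theorem opX_succ (f : Coeffs) (i j : ℕ) :
    opX f (i + 1) j = f i j + (j + 1) / ((i + j + 2) * (i + j + 3)) * f (i + 1) (j + 1) := by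
  simp only [opX, LinearMap.coe_mk, AddHom.coe_mk]
  push_cast
  ring_nf

theorem opY_zero (f : Coeffs) (i : ℕ) :
    opY f i 0 = - ((i + 1) / ((i + 1) * (i + 2)) * f (i + 1) 0) := by
  simp [opY]

theorem opY_succ (f : Coeffs) (i j : ℕ) :
    opY f i (j + 1) = f i j - (i + 1) / ((i + j + 2) * (i + j + 3)) * f (i + 1) (j + 1) := by
  simp only [opY, LinearMap.coe_mk, AddHom.coe_mk]
  push_cast
  ring_nf

theorem commutator_apply (f : Coeffs) :
    (opX * opY - opY * opX) f = f 0 0 • mono 0 0 := by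
  funext i j
  simp only [LinearMap.sub_apply, Module.End.mul_apply, Pi.sub_apply, Pi.smul_apply, smul_eq_mul,
    mono]
  rcases i with _ | i <;> rcases j with _ | j
  · simp [opX_zero, opX_succ, opY_zero, opY_succ]
    ring
  · simp [opX_zero, opX_succ, opY_succ]
    field_simp (disch := (norm_cast <;> omega))
    ring
  · simp [opX_succ, opY_zero, opY_succ]
    field_simp (disch := (norm_cast <;> omega))
    ring
  · simp [opX_succ, opY_succ]
    field_simp (disch := (norm_cast <;> omega))
    ring

theorem opX_mono_zero (k : ℕ) : opX (mono k 0) = mono (k + 1) 0 := by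
  funext i j
  cases i <;> simp [opX_zero, opX_succ, mono]

theorem opY_mono_zero (l : ℕ) : opY (mono 0 l) = mono 0 (l + 1) := by
  funext i j
  cases j <;> simp [opY_zero, opY_succ, mono]

theorem opX_mono_succ (k l : ℕ) :
    opX (mono k (l + 1)) = mono (k + 1) (l + 1) +
      ((l + 1) / ((k + l + 1) * (k + l + 2)) : ℂ) • mono k l := by
  funext i j
  by_cases h : i = k ∧ j = l
  · obtain ⟨rfl, rfl⟩ := h
    cases i <;> simp [opX, mono]
  · cases i <;> simp [opX, mono, h]

theorem opY_mono_succ (k l : ℕ) :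
    opY (mono (k + 1) l) = mono (k + 1) (l + 1) -
      ((k + 1) / ((k + l + 1) * (k + l + 2)) : ℂ) • mono k l := by
  funext i j
  by_cases h : i = k ∧ j = l
  · obtain ⟨rfl, rfl⟩ := h
    cases j <;> simp [opY, mono]
  · cases j <;> simp [opY, mono, h]

theorem choose_smul_mono_of_rec {h : ℕ → ℕ → Coeffs} (h00 : h 0 0 = mono 0 0)
    (hx : ∀ k, h (k + 1) 0 = opX (h k 0)) (hy : ∀ l, h 0 (l + 1) = opY (h 0 l))
    (hxy : ∀ k l, h (k + 1) (l + 1) = opX (h k (l + 1)) + opY (h (k + 1) l)) (k l : ℕ) :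
    h k l = ((k + l).choose k : ℂ) • mono k l := by
  induction k generalizing l with
  | zero =>
    induction l with
    | zero => simp [h00]
    | succ l ihl => simpa [hy, opY_mono_zero] using congrArg opY ihl
  | succ k ihk =>
    induction l with
    | zero => simpa [hx, opX_mono_zero] using congrArg opX (ihk 0)
    | succ l ihl =>
      have e1 : (k + (l + 1)).choose k = (k + l + 1).choose k := rfl
      have e2 : k + 1 + l = k + l + 1 := by ring
      have e3 : k + 1 + (l + 1) = k + l + 1 + 1 := by ring
      rw [hxy, ihk, ihl, map_smul, map_smul, opX_mono_succ, opY_mono_succ, e1, e2, e3,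
        Nat.choose_succ_succ (k + l + 1) k]
      have hc : ((k + l + 1).choose (k + 1) : ℂ) * (k + 1) = (k + l + 1).choose k * (l + 1) := by
        have := Nat.choose_succ_right_eq (k + l + 1) k
        rw [show k + l + 1 - k = l + 1 by omega] at this
        exact_mod_cast this
      have hz : ((k + l + 1).choose k * ((l + 1) / ((k + l + 1) * (k + l + 2))) : ℂ) =
          (k + l + 1).choose (k + 1) * ((k + 1) / ((k + l + 1) * (k + l + 2))) := by
        rw [← mul_div_assoc, ← mul_div_assoc, hc]
      rw [smul_add, smul_sub, smul_smul, smul_smul, hz, Nat.cast_add, add_smul]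
      abel

open MulOpposite

/-- The action of the free algebra on `Coeffs` from the left. -/
def leftRep : FA →ₐ[ℂ] Module.End ℂ Coeffs := FreeAlgebra.lift ℂ ![opX, opY]

/-- The action of the free algebra on `Coeffs` from the right, with the generators exchanged. -/
def rightRep : FA →ₐ[ℂ] (Module.End ℂ Coeffs)ᵐᵒᵖ := FreeAlgebra.lift ℂ ![op opY, op opX]

@[simp] theorem leftRep_Xg_zero : leftRep (Xg 0) = opX := by simp [leftRep, Xg]

@[simp] theorem leftRep_Xg_one : leftRep (Xg 1) = opY := by simp [leftRep, Xg]

@[simp] theorem rightRep_Xg_zero : rightRep (Xg 0) = op opY := by simp [rightRep, Xg]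

@[simp] theorem rightRep_Xg_one : rightRep (Xg 1) = op opX := by simp [rightRep, Xg]

theorem leftRep_Cc_apply (f : Coeffs) : leftRep Cc f = f 0 0 • mono 0 0 := by
  rw [← commutator_apply]
  simp [Cc]

theorem rightRep_Cc_apply (f : Coeffs) : (rightRep Cc).unop f = f 0 0 • mono 0 0 := by
  rw [← commutator_apply]
  simp [Cc]

@[simp] theorem Xs_one_zero : Xs (1, 0) = Xg 0 := by simp [Xs]

@[simp] theorem Xs_zero_one : Xs (0, 1) = Xg 1 := by simp [Xs]

theorem Xkl_eq_wordSum (k l : ℕ) :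
    Xkl (1, 0) (0, 1) k l = ((k + l).choose k : ℂ)⁻¹ • wordSum (Xg 0) (Xg 1) (k + l) k := by
  simp [Xkl, wordSum]

theorem leftRep_wordSum_apply (k l : ℕ) :
    leftRep (wordSum (Xg 0) (Xg 1) (k + l) k) (mono 0 0) = ((k + l).choose k : ℂ) • mono k l := by
  refine choose_smul_mono_of_rec
    (h := fun k l => leftRep (wordSum (Xg 0) (Xg 1) (k + l) k) (mono 0 0)) ?_ ?_ ?_ ?_ k l
  · simp [wordSum_zero_zero]
  · intro k
    simp [wordSum_succ_succ, wordSum_of_lt]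
  · intro l
    simp [← add_assoc, wordSum_succ_zero]
  · intro k l
    simp only [← add_assoc, wordSum_succ_succ]
    simp [add_right_comm k 1 l]

theorem rightRep_wordSum_apply (k l : ℕ) :
    (rightRep (wordSum (Xg 0) (Xg 1) (k + l) k)).unop (mono 0 0) =
      ((k + l).choose k : ℂ) • mono l k := by
  have key := choose_smul_mono_of_rec
    (h := fun l k => (rightRep (wordSum (Xg 0) (Xg 1) (k + l) k)).unop (mono 0 0)) ?_ ?_ ?_ ?_ l k
  · rw [key, add_comm l k, Nat.choose_symm_add]
  · simp [wordSum_zero_zero]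
  · intro k
    simp [← add_assoc, wordSum_succ_zero']
  · intro l
    simp [wordSum_succ_succ', wordSum_of_lt]
  · intro l k
    simp only [← add_assoc, wordSum_succ_succ']
    simp [add_right_comm k 1 l, add_comm]

theorem cast_choose_add_ne_zero (k l : ℕ) : ((k + l).choose k : ℂ) ≠ 0 :=
  Nat.cast_ne_zero.2 (Nat.choose_pos (Nat.le_add_right k l)).ne'

theorem leftRep_Xkl_apply (k l : ℕ) :
    leftRep (Xkl (1, 0) (0, 1) k l) (mono 0 0) = mono k l := by
  rw [Xkl_eq_wordSum, map_smul, LinearMap.smul_apply, leftRep_wordSum_apply,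
    inv_smul_smul₀ (cast_choose_add_ne_zero k l)]

theorem rightRep_Xkl_apply (k l : ℕ) :
    (rightRep (Xkl (1, 0) (0, 1) k l)).unop (mono 0 0) = mono l k := by
  rw [Xkl_eq_wordSum, map_smul, unop_smul, LinearMap.smul_apply, rightRep_wordSum_apply,
    inv_smul_smul₀ (cast_choose_add_ne_zero k l)]

theorem mono_apply_zero_zero (p : ℕ × ℕ) : mono p.1 p.2 0 0 = if p = 0 then 1 else 0 := by
  simp [mono, Prod.ext_iff, eq_comm]

theorem leftRep_prod_intersperse_apply (p : ℕ × ℕ) (L : List (ℕ × ℕ)) :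
    leftRep (((p :: L).map fun q => Xkl (1, 0) (0, 1) q.1 q.2).intersperse Cc).prod (mono 0 0) =
      if ∀ q ∈ L, q = 0 then mono p.1 p.2 else 0 := by
  induction L generalizing p with
  | nil => simp [leftRep_Xkl_apply]
  | cons q L ih =>
    have := ih q
    simp only [List.map_cons] at this
    simp only [List.map_cons, List.intersperse_cons_cons, List.prod_cons, map_mul,
      Module.End.mul_apply, this, leftRep_Cc_apply, map_smul, leftRep_Xkl_apply, List.mem_cons,
      forall_eq_or_imp]
    by_cases h : ∀ q ∈ L, q = 0
    · simp only [if_pos h, and_iff_left h, mono_apply_zero_zero]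
      split_ifs <;> simp
    · rw [if_neg h, if_neg fun H => h H.2]
      simp

theorem rightRep_prod_intersperse_apply (p : ℕ × ℕ) (L : List (ℕ × ℕ)) :
    (rightRep (((L ++ [p]).map fun q => Xkl (1, 0) (0, 1) q.1 q.2).intersperse Cc).prod).unop
      (mono 0 0) = if ∀ q ∈ L, q = 0 then mono p.2 p.1 else 0 := by
  induction L with
  | nil => simp [rightRep_Xkl_apply]
  | cons q L ih =>
    obtain ⟨r, M, hM⟩ : ∃ r M, L ++ [p] = r :: M := List.exists_cons_of_ne_nil (by simp)
    rw [hM, List.map_cons] at ih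
    simp only [List.cons_append, hM, List.map_cons, List.intersperse_cons_cons, List.prod_cons,
      map_mul, unop_mul, Module.End.mul_apply, rightRep_Xkl_apply, rightRep_Cc_apply, map_smul, ih,
      List.mem_cons, forall_eq_or_imp, mono_apply_zero_zero (q.2, q.1)]
    have hswap : (q.2, q.1) = (0 : ℕ × ℕ) ↔ q = 0 := by simp [Prod.ext_iff, and_comm]
    simp only [hswap, ite_and]
    split_ifs <;> simp

theorem opY_pow_mono_zero (n : ℕ) : (opY ^ n) (mono 0 0) = mono 0 n := by
  induction n with
  | zero => simp
  | succ n ih => rw [pow_succ', Module.End.mul_apply, ih, opY_mono_zero]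

theorem choose_div_descFactorial_succ {m n i j : ℕ} (h : j + m = n + i) :
    ((m + 1).choose (i + 1) / (n + i + 2).descFactorial (m - i) : ℂ) =
      m.choose i / (n + i + 1).descFactorial (m - i) +
        (j + 1) / ((i + j + 2) * (i + j + 3)) *
          (m.choose (i + 1) / (n + i + 2).descFactorial (m - (i + 1))) := by
  rcases lt_trichotomy m i with hmi | rfl | hmi
  · simp [Nat.choose_eq_zero_of_lt, hmi, hmi.trans]
  · simp
  · obtain ⟨b, rfl⟩ := Nat.exists_eq_add_of_lt hmi
    obtain rfl : n = j + b + 1 := by omega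
    set N := i + j + b + 2 with hN
    have hN1 : j + b + 1 + i + 1 = N := by omega
    have hN2 : j + b + 1 + i + 2 = N + 1 := by omega
    have hb : i + b + 1 - i = b + 1 := by omega
    have hb' : i + b + 1 - (i + 1) = b := by omega
    have hD : (N.descFactorial b : ℂ) ≠ 0 :=
      Nat.cast_ne_zero.2 (mt Nat.descFactorial_eq_zero_iff_lt.1 (by omega))
    have h1 : (N.descFactorial (b + 1) : ℂ) = (i + j + 2) * N.descFactorial b := by
      rw [Nat.descFactorial_succ, show N - b = i + j + 2 by omega]
      push_cast
      ring
    have h2 : ((N + 1).descFactorial (b + 1) : ℂ) = (N + 1) * N.descFactorial b := by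
      rw [Nat.succ_descFactorial_succ]
      push_cast
      ring
    have h3 : ((i + j + 3) * (N + 1).descFactorial b : ℂ) = (N + 1) * N.descFactorial b := by
      rw [← h2, Nat.descFactorial_succ, show N + 1 - b = i + j + 3 by omega]
      push_cast
      ring
    have hc : ((i + b + 1).choose (i + 1) * (i + 1) : ℂ) = (i + b + 1).choose i * (b + 1) := by
      have := Nat.choose_succ_right_eq (i + b + 1) i
      rw [hb] at this
      exact_mod_cast this
    have hij2 : (i + j + 2 : ℂ) ≠ 0 := by exact_mod_cast (i + j + 1).succ_ne_zero
    have hij3 : (i + j + 3 : ℂ) ≠ 0 := by exact_mod_cast (i + j + 2).succ_ne_zero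
    have hN0 : (N + 1 : ℂ) ≠ 0 := by exact_mod_cast N.succ_ne_zero
    have h4 : ((N + 1).descFactorial b : ℂ) = (N + 1) * N.descFactorial b / (i + j + 3) := by
      rw [← h3, mul_div_cancel_left₀ _ hij3]
    rw [hN1, hN2, hb, hb', h1, h2, h4, Nat.choose_succ_succ]
    push_cast
    field_simp
    rw [hN]
    push_cast
    linear_combination hc

theorem choose_div_descFactorial_zero {m n j : ℕ} (h : j + (m + 1) = n) :
    (1 / (n + 1).descFactorial (m + 1) : ℂ) =
      (j + 1) / ((j + 1) * (j + 2)) * (1 / (n + 1).descFactorial m) := by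
  have hj1 : (j + 1 : ℂ) ≠ 0 := by exact_mod_cast j.succ_ne_zero
  have hj2 : (j + 2 : ℂ) ≠ 0 := by exact_mod_cast (j + 1).succ_ne_zero
  have hD : ((n + 1).descFactorial m : ℂ) ≠ 0 :=
    Nat.cast_ne_zero.2 (mt Nat.descFactorial_eq_zero_iff_lt.1 (by omega))
  rw [Nat.descFactorial_succ, show n + 1 - m = j + 2 by omega]
  push_cast
  field_simp

theorem opX_pow_mono_apply (m n i j : ℕ) :
    (opX ^ m) (mono 0 n) i j =
      if j + m = n + i then (m.choose i / (n + i + 1).descFactorial (m - i) : ℂ) else 0 := by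
  induction m generalizing i j with
  | zero => cases i <;> simp [mono]
  | succ m ih =>
    rw [pow_succ', Module.End.mul_apply]
    cases i with
    | zero =>
      rw [opX_zero, ih, show j + 1 + m = j + (m + 1) by ring]
      split_ifs with h
      · simpa using (choose_div_descFactorial_zero h).symm
      · simp
    | succ i =>
      rw [opX_succ, ih, ih]
      by_cases h : j + m = n + i
      · rw [if_pos h, if_pos (by omega), if_pos (by omega), Nat.add_sub_add_right]
        exact (choose_div_descFactorial_succ h).symm
      · rw [if_neg h, if_neg (by omega), if_neg (by omega), mul_zero, add_zero]

theorem opX_pow_opY_pow_apply (k l a : ℕ) :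
    (opX ^ (k + a)) ((opY ^ (l + a)) (mono 0 0)) k l =
      ((k + a).choose a : ℂ) / ((k + l + a + 1).descFactorial a : ℂ) := by
  rw [opY_pow_mono_zero, opX_pow_mono_apply, if_pos (by ring), Nat.choose_symm_add,
    Nat.add_sub_cancel_left, show l + a + k = k + l + a by ring]

theorem SatisfiesExpansion.apply_eq {R : List ℕ → List ℕ → ℂ} (hR : SatisfiesExpansion R)
    (Φ : FA →ₗ[ℂ] ℂ) {k l : ℕ} (K L : ∀ a, Fin (a + 1) → ℕ) (hK : ∀ a, ∑ i, K a i = k)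
    (hL : ∀ a, ∑ i, L a i = l)
    (hΦ : ∀ a ks ls, Φ (chain (1, 0) (0, 1) ks ls) = if ks = K a ∧ ls = L a then 1 else 0)
    (a : ℕ) :
    Φ (Xg 0 ^ (k + a) * Xg 1 ^ (l + a)) = R (List.ofFn (K a)) (List.ofFn (L a)) := by
  have key := congrArg Φ (hR (k + a) (l + a) (1, 0) (0, 1))
  simp only [Xs_one_zero, Xs_zero_one, map_sum, map_smul, hΦ, smul_eq_mul, mul_ite, mul_one,
    mul_zero] at key
  rw [key, sum_eq_single a, sum_eq_single (K a), sum_eq_single (L a)]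
  · simp [bra]
  · intro ls _ h
    simp [h]
  · intro h
    simp [Finset.Nat.mem_antidiagonalTuple, hL] at h
  · intro ks _ h
    simp [h]
  · intro h
    simp [Finset.Nat.mem_antidiagonalTuple, hK] at h
  · intro b hb hba
    rw [sum_eq_zero, mul_zero]
    intro ks hks
    refine sum_eq_zero fun ls _ => if_neg ?_
    rintro ⟨rfl, -⟩
    rw [Finset.Nat.mem_antidiagonalTuple, hK] at hks
    rw [mem_range] at hb
    omega
  · intro h
    simp at h

theorem chain_eq (l₁ l₂ : ℂ × ℂ) {a : ℕ} (ks ls : Fin a → ℕ) :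
    chain l₁ l₂ ks ls =
      (((List.ofFn fun i => (ks i, ls i)).map fun q => Xkl l₁ l₂ q.1 q.2).intersperse Cc).prod := by
  rw [chain, List.map_ofFn]
  rfl

theorem leftRep_chain_apply {a : ℕ} (ks ls : Fin (a + 1) → ℕ) (k l : ℕ) :
    leftRep (chain (1, 0) (0, 1) ks ls) (mono 0 0) k l =
      if ks = Fin.cons (α := fun _ => ℕ) k (fun _ => 0) ∧
        ls = Fin.cons (α := fun _ => ℕ) l (fun _ => 0) then 1 else 0 := by
  rw [chain_eq, List.ofFn_succ, leftRep_prod_intersperse_apply]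
  simp only [List.forall_mem_ofFn_iff, funext_iff, Fin.forall_fin_succ, Fin.cons_zero,
    Fin.cons_succ, Prod.ext_iff, Prod.fst_zero, Prod.snd_zero, forall_and, ite_apply, mono,
    Pi.zero_apply, ← ite_and, eq_comm (a := k), eq_comm (a := l)]
  congr 1
  exact propext (by tauto)

theorem rightRep_chain_apply {a : ℕ} (ks ls : Fin (a + 1) → ℕ) (k l : ℕ) :
    (rightRep (chain (1, 0) (0, 1) ks ls)).unop (mono 0 0) l k =
      if ks = Fin.snoc (α := fun _ => ℕ) (fun _ => 0) k ∧
        ls = Fin.snoc (α := fun _ => ℕ) (fun _ => 0) l then 1 else 0 := by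
  rw [chain_eq, List.ofFn_succ', List.concat_eq_append, rightRep_prod_intersperse_apply]
  simp only [List.forall_mem_ofFn_iff, funext_iff, Fin.forall_fin_succ', Fin.snoc_last,
    Fin.snoc_castSucc, Prod.ext_iff, Prod.fst_zero, Prod.snd_zero, forall_and, ite_apply, mono,
    Pi.zero_apply, ← ite_and, eq_comm (a := k), eq_comm (a := l)]
  congr 1
  exact propext (by tauto)

/-- The coefficient of `x ^ k * y ^ l`. -/
def coeffFunctional (k l : ℕ) : Coeffs →ₗ[ℂ] ℂ :=
  LinearMap.proj (φ := fun _ => ℂ) l ∘ₗ LinearMap.proj (φ := fun _ => ℕ → ℂ) k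

theorem statement4 (R : List ℕ → List ℕ → ℂ) (hR : SatisfiesExpansion R)
    (k l k' l' a : ℕ) :
    R (k :: List.replicate a 0) (l :: List.replicate a 0) =
      (Nat.choose (k + a) a : ℂ) / (Nat.descFactorial (k + l + a + 1) a : ℂ) ∧
    R (List.replicate a 0 ++ [k']) (List.replicate a 0 ++ [l']) =
      (Nat.choose (l' + a) a : ℂ) / (Nat.descFactorial (k' + l' + a + 1) a : ℂ) := by
  constructor
  · have key := hR.apply_eq (k := k) (l := l)
      (coeffFunctional k l ∘ₗ LinearMap.applyₗ (mono 0 0) ∘ₗ leftRep.toLinearMap)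
      (fun a => Fin.cons (α := fun _ => ℕ) k fun _ => 0)
      (fun a => Fin.cons (α := fun _ => ℕ) l fun _ => 0)
      (fun a => by simp [Fin.sum_univ_succ]) (fun a => by simp [Fin.sum_univ_succ])
      (fun a ks ls => leftRep_chain_apply ks ls k l) a
    simp only [List.ofFn_succ, Fin.cons_zero, Fin.cons_succ, List.ofFn_const] at key
    rw [← key, ← opX_pow_opY_pow_apply]
    simp [coeffFunctional]
  · have key := hR.apply_eq (k := k') (l := l')
      (coeffFunctional l' k' ∘ₗ LinearMap.applyₗ (mono 0 0) ∘ₗ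
        (opLinearEquiv ℂ).symm.toLinearMap ∘ₗ rightRep.toLinearMap)
      (fun a => Fin.snoc (α := fun _ => ℕ) (fun _ => 0) k')
      (fun a => Fin.snoc (α := fun _ => ℕ) (fun _ => 0) l')
      (fun a => by simp [Fin.sum_univ_castSucc]) (fun a => by simp [Fin.sum_univ_castSucc])
      (fun a ks ls => rightRep_chain_apply ks ls k' l') a
    simp only [List.ofFn_succ', Fin.snoc_last, Fin.snoc_castSucc, List.ofFn_const,
      List.concat_eq_append] at key
    rw [← key, add_comm k' l', ← opX_pow_opY_pow_apply]
    simp [coeffFunctional]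

end
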